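/- arXiv:1310.2768 — 5 statements merged into one kernel-verified Lean document; each statement's English description precedes it below -/
import Mathlib

section
/- Let X and Y be finite geometric simplicial complexes in Euclidean spaces ℝ^N and ℝ^M respectively. Then there exists ε₀ > 0 such that for every ε with 0 < ε < ε₀ and every simplicial map f : |X| → |Y|, if f is an ε-controlled homotopy equivalence (with control maps f and id_{|Y|}), then f is homotopic (through continuous maps |X| → |Y|) to a continuous map F : |X| → |Y| which is a Y-triangular homotopy equivalence. -/
noncomputable section
open Metric Set

variable {E F : Type*} [NormedAddCommGroup E] [NormedSpace ℝ E]
  [NormedAddCommGroup F] [NormedSpace ℝ F]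

/-- The boundary of the simplex spanned by the finite (affinely independent) set `s`:
the union of the convex hulls of the proper nonempty subsets of `s`. -/
def simplexBoundary (s : Finset E) : Set E :=
  ⋃ (t : Finset E) (_ : t ⊂ s) (_ : t.Nonempty), convexHull ℝ (t : Set E)

/-- The combinatorial interior `σ̊` of the simplex spanned by `s`. -/
def simplexInterior (s : Finset E) : Set E :=
  convexHull ℝ (s : Set E) \ simplexBoundary s

/-- A simplicial map `f : |X| → |Y|`: continuous on `|X|`, mapping `|X|` into `|Y|`,
sending the vertex set of each face of `X` onto the vertex set of some face of `Y`
(in particular vertices to vertices), and restricting to an affine map on each simplex. -/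
def IsSimplicialMap (X : Geometry.SimplicialComplex ℝ E)
    (Y : Geometry.SimplicialComplex ℝ F) (f : E → F) : Prop :=
  ContinuousOn f X.space ∧ MapsTo f X.space Y.space ∧
  (∀ s ∈ X.faces, ∃ t ∈ Y.faces, f '' (s : Set E) = (t : Set F)) ∧
  (∀ s ∈ X.faces, ∃ A : E →ᵃ[ℝ] F, EqOn f A (convexHull ℝ (s : Set E)))

/-- `f` and `g` are homotopic through continuous maps `|X| → |Y|`. -/
def HomotopicOn (X : Geometry.SimplicialComplex ℝ E)
    (Y : Geometry.SimplicialComplex ℝ F) (f g : E → F) : Prop :=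
  ∃ H : E × ℝ → F,
    ContinuousOn H (X.space ×ˢ Icc (0:ℝ) 1) ∧
    (∀ x ∈ X.space, ∀ t ∈ Icc (0:ℝ) 1, H (x, t) ∈ Y.space) ∧
    (∀ x ∈ X.space, H (x, 0) = f x) ∧
    (∀ x ∈ X.space, H (x, 1) = g x)

/-- `f : |X| → |Y|` is an `ε`-controlled homotopy equivalence, with control maps `f`
and `id_{|Y|}`. -/
def EpsControlledHE (X : Geometry.SimplicialComplex ℝ E)
    (Y : Geometry.SimplicialComplex ℝ F) (f : E → F) (ε : ℝ) : Prop :=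
  ∃ (g : F → E) (h₁ : F × ℝ → F) (h₂ : E × ℝ → E),
    ContinuousOn g Y.space ∧ MapsTo g Y.space X.space ∧
    ContinuousOn h₁ (Y.space ×ˢ Icc (0:ℝ) 1) ∧
    (∀ y ∈ Y.space, ∀ t ∈ Icc (0:ℝ) 1, h₁ (y, t) ∈ Y.space) ∧
    (∀ y ∈ Y.space, h₁ (y, 0) = f (g y)) ∧
    (∀ y ∈ Y.space, h₁ (y, 1) = y) ∧
    ContinuousOn h₂ (X.space ×ˢ Icc (0:ℝ) 1) ∧
    (∀ x ∈ X.space, ∀ t ∈ Icc (0:ℝ) 1, h₂ (x, t) ∈ X.space) ∧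
    (∀ x ∈ X.space, h₂ (x, 0) = g (f x)) ∧
    (∀ x ∈ X.space, h₂ (x, 1) = x) ∧
    (∀ y ∈ Y.space, dist y (f (g y)) < ε) ∧
    (∀ y ∈ Y.space, ∀ t ∈ Icc (0:ℝ) 1, dist y (h₁ (y, t)) < ε) ∧
    (∀ x ∈ X.space, ∀ t ∈ Icc (0:ℝ) 1, dist (f x) (f (h₂ (x, t))) < ε)

/-- `F'` is a `Y`-triangular homotopy equivalence `|X| → |Y|`. -/
def TriangularHE (X : Geometry.SimplicialComplex ℝ E)
    (Y : Geometry.SimplicialComplex ℝ F) (F' : E → F) : Prop :=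
  ∃ (G : F → E) (H₁ : F × ℝ → F) (H₂ : E × ℝ → E),
    ContinuousOn G Y.space ∧ MapsTo G Y.space X.space ∧
    ContinuousOn H₁ (Y.space ×ˢ Icc (0:ℝ) 1) ∧
    (∀ y ∈ Y.space, ∀ t ∈ Icc (0:ℝ) 1, H₁ (y, t) ∈ Y.space) ∧
    (∀ y ∈ Y.space, H₁ (y, 0) = F' (G y)) ∧
    (∀ y ∈ Y.space, H₁ (y, 1) = y) ∧
    ContinuousOn H₂ (X.space ×ˢ Icc (0:ℝ) 1) ∧
    (∀ x ∈ X.space, ∀ t ∈ Icc (0:ℝ) 1, H₂ (x, t) ∈ X.space) ∧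
    (∀ x ∈ X.space, H₂ (x, 0) = G (F' x)) ∧
    (∀ x ∈ X.space, H₂ (x, 1) = x) ∧
    (∀ s ∈ Y.faces,
      (∀ y ∈ simplexInterior s, F' (G y) ∈ convexHull ℝ (s : Set F)) ∧
      (∀ y ∈ simplexInterior s, ∀ t ∈ Icc (0:ℝ) 1, H₁ (y, t) ∈ convexHull ℝ (s : Set F)) ∧
      (∀ x ∈ X.space, F' x ∈ simplexInterior s →
        ∀ t ∈ Icc (0:ℝ) 1, F' (H₂ (x, t)) ∈ convexHull ℝ (s : Set F)))

open Geometry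

set_option linter.unusedSectionVars false

/-- `t` is a system of barycentric coordinates of `x` with respect to the finite set `s`,
extended by zero outside `s`. -/
def IsBarycentric (s : Finset E) (t : E → ℝ) (x : E) : Prop :=
  (∀ v, 0 ≤ t v) ∧ (∀ v ∉ s, t v = 0) ∧ ∑ v ∈ s, t v = 1 ∧ ∑ v ∈ s, t v • v = x

lemma IsBarycentric.mono {s s' : Finset E} {t : E → ℝ} {x : E} (h : IsBarycentric s t x)
    (hs : s ⊆ s') : IsBarycentric s' t x := by
  obtain ⟨h0, h1, h2, h3⟩ := h
  refine ⟨h0, fun v hv => h1 v fun h => hv (hs h), ?_, ?_⟩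
  · rw [← h2]
    exact (Finset.sum_subset hs fun v _ hv => h1 v hv).symm
  · rw [← h3]
    exact (Finset.sum_subset hs fun v _ hv => by rw [h1 v hv, zero_smul]).symm

lemma IsBarycentric.mem_convexHull {s : Finset E} {t : E → ℝ} {x : E}
    (h : IsBarycentric s t x) : x ∈ convexHull ℝ (s : Set E) :=
  Finset.mem_convexHull'.2 ⟨t, fun v _ => h.1 v, h.2.2.1, h.2.2.2⟩

lemma exists_isBarycentric {s : Finset E} {x : E} (h : x ∈ convexHull ℝ (s : Set E)) :
    ∃ t, IsBarycentric s t x := by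
  classical
  obtain ⟨w, h0, h1, h2⟩ := Finset.mem_convexHull'.1 h
  refine ⟨fun v => if v ∈ s then w v else 0, fun v => ?_, fun v hv => if_neg hv, ?_, ?_⟩
  · dsimp only
    split_ifs with hv
    exacts [h0 v hv, le_rfl]
  · rw [← h1]
    exact Finset.sum_congr rfl fun v hv => if_pos hv
  · rw [← h2]
    exact Finset.sum_congr rfl fun v hv => by simp only [if_pos hv]

lemma IsBarycentric.eq_of_affineIndependent {s : Finset E} {t t' : E → ℝ} {x : E}
    (hs : AffineIndependent ℝ ((↑) : s → E))
    (h : IsBarycentric s t x) (h' : IsBarycentric s t' x) : t = t' := by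
  have key := affineIndependent_iff.1 hs Finset.univ (fun v => t v - t' v)
    (by
      rw [Finset.sum_sub_distrib, Finset.univ_eq_attach, Finset.sum_attach s t,
        Finset.sum_attach s t', h.2.2.1, h'.2.2.1, sub_self])
    (by
      simp only [sub_smul]
      rw [Finset.sum_sub_distrib, Finset.univ_eq_attach,
        Finset.sum_attach s fun v => t v • v, Finset.sum_attach s fun v => t' v • v,
        h.2.2.2, h'.2.2.2, sub_self])
  funext v
  by_cases hv : v ∈ s
  · exact sub_eq_zero.1 (key ⟨v, hv⟩ (Finset.mem_univ _))
  · rw [h.2.1 v hv, h'.2.1 v hv]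

lemma IsBarycentric.unique {X : SimplicialComplex ℝ E} {s s' : Finset E} {t t' : E → ℝ} {x : E}
    (hs : s ∈ X.faces) (hs' : s' ∈ X.faces)
    (h : IsBarycentric s t x) (h' : IsBarycentric s' t' x) : t = t' := by
  classical
  have hx := X.inter_subset_convexHull hs hs' ⟨h.mem_convexHull, h'.mem_convexHull⟩
  rw [← Finset.coe_inter] at hx
  obtain ⟨w, hw⟩ := exists_isBarycentric hx
  exact (h.eq_of_affineIndependent (X.indep hs) (hw.mono Finset.inter_subset_left)).trans
    (h'.eq_of_affineIndependent (X.indep hs') (hw.mono Finset.inter_subset_right)).symm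

open Classical in
/-- The barycentric coordinates of a point of `|X|`, extended by zero to all of `E`. -/
def baryCoord (X : SimplicialComplex ℝ E) (x : E) : E → ℝ :=
  if h : ∃ t, ∃ s ∈ X.faces, IsBarycentric s t x then h.choose else 0

lemma IsBarycentric.baryCoord_eq {X : SimplicialComplex ℝ E} {s : Finset E} {t : E → ℝ} {x : E}
    (hs : s ∈ X.faces) (h : IsBarycentric s t x) : baryCoord X x = t := by
  have hex : ∃ t, ∃ s ∈ X.faces, IsBarycentric s t x := ⟨t, s, hs, h⟩
  rw [baryCoord, dif_pos hex]
  obtain ⟨s', hs', h'⟩ := hex.choose_spec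
  exact h'.unique hs' hs h

lemma isBarycentric_baryCoord {X : SimplicialComplex ℝ E} {s : Finset E} {x : E}
    (hs : s ∈ X.faces) (hx : x ∈ convexHull ℝ (s : Set E)) :
    IsBarycentric s (baryCoord X x) x := by
  obtain ⟨t, ht⟩ := exists_isBarycentric hx
  rwa [ht.baryCoord_eq hs]

lemma isBarycentric_baryCoord_of_mem_space {X : SimplicialComplex ℝ E} {U : Finset E}
    (hU : ∀ s ∈ X.faces, s ⊆ U) {x : E} (hx : x ∈ X.space) :
    IsBarycentric U (baryCoord X x) x := by
  obtain ⟨s, hs, hxs⟩ := SimplicialComplex.mem_space_iff.1 hx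
  exact (isBarycentric_baryCoord hs hxs).mono (hU s hs)

lemma isCompact_setOf_isBarycentric (s : Finset E) :
    IsCompact {t : E → ℝ | ∃ x, IsBarycentric s t x} := by
  have hc : IsCompact (Set.univ.pi fun _ : E => Icc (0 : ℝ) 1) :=
    isCompact_univ_pi fun _ => isCompact_Icc
  refine hc.of_isClosed_subset ?_ ?_
  · have : {t : E → ℝ | ∃ x, IsBarycentric s t x} =
        (⋂ v, {t : E → ℝ | 0 ≤ t v}) ∩ ((⋂ v ∈ (↑s : Set E)ᶜ, {t : E → ℝ | t v = 0}) ∩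
          {t : E → ℝ | ∑ v ∈ s, t v = 1}) := by
      ext t
      simp [IsBarycentric]
    rw [this]
    refine (isClosed_iInter fun v => isClosed_le continuous_const (continuous_apply v)).inter
      ((isClosed_biInter fun v _ => isClosed_eq (continuous_apply v) continuous_const).inter
        (isClosed_eq (by fun_prop) continuous_const))
  · rintro t ⟨x, h0, h1, h2, -⟩ v -
    refine ⟨h0 v, ?_⟩
    by_cases hv : v ∈ s
    · rw [← h2]
      exact Finset.single_le_sum (fun u _ => h0 u) hv
    · rw [h1 v hv]
      exact zero_le_one

lemma isCompact_space_of_finite {X : SimplicialComplex ℝ E} (hX : X.faces.Finite) :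
    IsCompact X.space :=
  hX.isCompact_biUnion fun s _ => s.finite_toSet.isCompact_convexHull (𝕜 := ℝ)

lemma continuousOn_baryCoord {X : SimplicialComplex ℝ E} (hX : X.faces.Finite)
    {U : Finset E} (hU : ∀ s ∈ X.faces, s ⊆ U) : ContinuousOn (baryCoord X) X.space := by
  set K : Set (E → ℝ) := ⋃ s ∈ X.faces, {t | ∃ x, IsBarycentric s t x}
  have hK : IsCompact K := hX.isCompact_biUnion fun s _ => isCompact_setOf_isBarycentric s
  have hφ : Continuous fun t : E → ℝ => ∑ v ∈ U, t v • v := by fun_prop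
  rw [continuousOn_iff_isClosed]
  intro C hC
  refine ⟨_, ((hK.inter_right hC).image hφ).isClosed, ?_⟩
  ext x
  refine and_congr_left fun hx => ⟨fun h => ?_, ?_⟩
  · obtain ⟨s, hs, hxs⟩ := SimplicialComplex.mem_space_iff.1 hx
    have hb := isBarycentric_baryCoord hs hxs
    exact ⟨baryCoord X x, ⟨mem_biUnion hs ⟨x, hb⟩, h⟩, (hb.mono (hU s hs)).2.2.2⟩
  · rintro ⟨t, ⟨htK, htC⟩, rfl⟩
    obtain ⟨s, hs, x, hx'⟩ := mem_iUnion₂.1 htK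
    have hxe := (hx'.mono (hU s hs)).2.2.2
    simp only at hxe ⊢
    rw [hxe]
    change baryCoord X x ∈ C
    rwa [hx'.baryCoord_eq hs]

/-- The pushforward of coordinates along a vertex map. -/
def pushCoord (f : E → F) (U : Finset E) (t : E → ℝ) (v : F) : ℝ :=
  open Classical in ∑ w ∈ U, if f w = v then t w else 0

lemma sum_smul_pushCoord {f : E → F} {U : Finset E} {W : Finset F} (t : E → ℝ)
    (hf : ∀ w ∈ U, t w ≠ 0 → f w ∈ W)
    {G : Type*} [AddCommGroup G] [Module ℝ G] (c : F → G) :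
    ∑ v ∈ W, pushCoord f U t v • c v = ∑ w ∈ U, t w • c (f w) := by
  classical
  simp only [pushCoord, Finset.sum_smul]
  rw [Finset.sum_comm]
  refine Finset.sum_congr rfl fun w hw => ?_
  simp only [ite_smul, zero_smul, Finset.sum_ite_eq]
  split_ifs with h
  · rfl
  · rw [not_imp_comm.1 (hf w hw) h, zero_smul]

lemma IsBarycentric.map {X : SimplicialComplex ℝ E} {Y : SimplicialComplex ℝ F} {f : E → F}
    (hf : IsSimplicialMap X Y f) {U : Finset E} (hU : ∀ s ∈ X.faces, s ⊆ U) {s : Finset E}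
    (hs : s ∈ X.faces) {t : E → ℝ} {x : E} (h : IsBarycentric s t x) :
    ∃ r ∈ Y.faces, IsBarycentric r (pushCoord f U t) (f x) := by
  classical
  obtain ⟨-, -, hface, haff⟩ := hf
  obtain ⟨r, hr, hfr⟩ := hface s hs
  obtain ⟨A, hA⟩ := haff s hs
  have hsupp : ∀ w, t w ≠ 0 → f w ∈ r := fun w hw => by
    have hws : w ∈ s := by
      by_contra hws
      exact hw (h.2.1 w hws)
    exact Finset.mem_coe.1 (hfr ▸ mem_image_of_mem f (Finset.mem_coe.2 hws))
  refine ⟨r, hr, fun v => ?_, fun v hv => ?_, ?_, ?_⟩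
  · refine Finset.sum_nonneg fun w _ => ?_
    split_ifs
    exacts [h.1 w, le_rfl]
  · refine Finset.sum_eq_zero fun w _ => ?_
    split_ifs with hw
    · by_contra h0
      exact hv (hw ▸ hsupp w h0)
    · rfl
  · have := sum_smul_pushCoord (W := r) (U := U) t (fun w _ => hsupp w) (fun _ => (1 : ℝ))
    simp only [smul_eq_mul, mul_one] at this
    rw [this, (h.mono (hU s hs)).2.2.1]
  · rw [sum_smul_pushCoord t (fun w _ => hsupp w) fun v => v,
      ← Finset.sum_subset (hU s hs) fun w _ hw => by rw [h.2.1 w hw, zero_smul],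
      hA h.mem_convexHull, ← h.2.2.2,
      ← Finset.affineCombination_eq_linear_combination s (fun v => v) t h.2.2.1,
      Finset.map_affineCombination _ _ _ h.2.2.1,
      Finset.affineCombination_eq_linear_combination _ _ _ h.2.2.1]
    exact Finset.sum_congr rfl fun w hw => by
      rw [hA (subset_convexHull ℝ _ (Finset.mem_coe.2 hw))]; rfl

lemma isSimplicialMap_id (Y : SimplicialComplex ℝ F) : IsSimplicialMap Y Y id :=
  ⟨continuousOn_id, mapsTo_id _, fun s hs => ⟨s, hs, image_id _⟩,
    fun _ _ => ⟨AffineMap.id ℝ F, fun _ _ => rfl⟩⟩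

/-- The factor by which the coordinate at `v` is multiplied in the homotopy from the
normalized truncation `t ↦ max (t - δ) 0` of barycentric coordinates (at `a = 0`) to the
identity (at `a = 1`). -/
def squeezeWeight (δ : ℝ) (W : Finset F) (a : ℝ) (t : F → ℝ) (v : F) : ℝ :=
  (1 - a) * (max (t v - δ) 0 / max (t v) δ / ∑ u ∈ W, max (t u - δ) 0) + a

lemma squeezeWeight_one (δ : ℝ) (W : Finset F) (t : F → ℝ) (v : F) :
    squeezeWeight δ W 1 t v = 1 := by
  simp [squeezeWeight]

lemma sum_truncation_pos {δ : ℝ} {W : Finset F} (hW : W.card * δ < 1) {t : F → ℝ}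
    (ht : ∑ v ∈ W, t v = 1) : 0 < ∑ u ∈ W, max (t u - δ) 0 :=
  calc 0 < ∑ u ∈ W, (t u - δ) := by
        rw [Finset.sum_sub_distrib, ht, Finset.sum_const, nsmul_eq_mul]
        linarith
    _ ≤ _ := Finset.sum_le_sum fun _ _ => le_max_left _ _

lemma squeezeWeight_nonneg {δ : ℝ} (hδ : 0 < δ) (W : Finset F) {a : ℝ} (ha : a ∈ Icc (0 : ℝ) 1)
    (t : F → ℝ) (v : F) : 0 ≤ squeezeWeight δ W a t v := by
  have h1 : 0 ≤ 1 - a := sub_nonneg.2 ha.2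
  have h2 : 0 ≤ max (t v) δ := hδ.le.trans (le_max_right _ _)
  have h3 : 0 ≤ ∑ u ∈ W, max (t u - δ) 0 := Finset.sum_nonneg fun _ _ => le_max_right _ _
  exact add_nonneg (mul_nonneg h1 (div_nonneg (div_nonneg (le_max_right _ _) h2) h3)) ha.1

lemma truncation_div_mul {δ b : ℝ} (hδ : 0 < δ) :
    max (b - δ) 0 / max b δ * b = max (b - δ) 0 := by
  rcases le_total b δ with h | h
  · simp [max_eq_right (sub_nonpos.2 h)]
  · rw [max_eq_left h, div_mul_cancel₀ _ (hδ.trans_le h).ne']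

lemma sum_squeezeWeight_mul {δ : ℝ} (hδ : 0 < δ) {W : Finset F} (hW : W.card * δ < 1) (a : ℝ)
    {t : F → ℝ} (ht : ∑ v ∈ W, t v = 1) : ∑ v ∈ W, t v * squeezeWeight δ W a t v = 1 := by
  have hS := sum_truncation_pos hW ht
  set S := ∑ u ∈ W, max (t u - δ) 0 with hSdef
  have : ∀ v, t v * squeezeWeight δ W a t v = (1 - a) / S * max (t v - δ) 0 + a * t v := fun v => by
    rw [squeezeWeight, ← hSdef]
    conv_rhs => rw [← truncation_div_mul (b := t v) hδ]
    ring
  simp only [this]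
  rw [Finset.sum_add_distrib, ← Finset.mul_sum, ← Finset.mul_sum, ht, ← hSdef]
  field_simp
  ring

/-- The lift along the simplicial map `f : |X| → |Y|` of the homotopy of `|Y|` that rescales
barycentric coordinates by `squeezeWeight`. -/
def squeezeMap (X : SimplicialComplex ℝ E) (Y : SimplicialComplex ℝ F) (f : E → F)
    (U : Finset E) (W : Finset F) (δ a : ℝ) (x : E) : E :=
  ∑ w ∈ U, (baryCoord X x w * squeezeWeight δ W a (baryCoord Y (f x)) (f w)) • w

section squeezeMap

variable {X : SimplicialComplex ℝ E} {Y : SimplicialComplex ℝ F} {f : E → F}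
  {U : Finset E} {W : Finset F} {δ : ℝ}

lemma squeezeMap_one (hU : ∀ s ∈ X.faces, s ⊆ U) {x : E} (hx : x ∈ X.space) :
    squeezeMap X Y f U W δ 1 x = x := by
  simp only [squeezeMap, squeezeWeight_one, mul_one]
  exact (isBarycentric_baryCoord_of_mem_space hU hx).2.2.2

lemma baryCoord_map (hf : IsSimplicialMap X Y f) (hU : ∀ s ∈ X.faces, s ⊆ U) {x : E}
    (hx : x ∈ X.space) : baryCoord Y (f x) = pushCoord f U (baryCoord X x) := by
  obtain ⟨s, hs, hxs⟩ := SimplicialComplex.mem_space_iff.1 hx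
  obtain ⟨r, hr, h⟩ := (isBarycentric_baryCoord hs hxs).map hf hU hs
  exact h.baryCoord_eq hr

lemma isBarycentric_squeezeMap (hf : IsSimplicialMap X Y f) (hU : ∀ s ∈ X.faces, s ⊆ U)
    (hW : ∀ s ∈ Y.faces, s ⊆ W) (hδ : 0 < δ) (hWδ : W.card * δ < 1)
    {a : ℝ} (ha : a ∈ Icc (0 : ℝ) 1) {s : Finset E} (hs : s ∈ X.faces) {x : E}
    (hx : x ∈ convexHull ℝ (s : Set E)) :
    IsBarycentric s
      (fun w => baryCoord X x w * squeezeWeight δ W a (baryCoord Y (f x)) (f w))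
      (squeezeMap X Y f U W δ a x) := by
  have hb := isBarycentric_baryCoord hs hx
  have hxX : x ∈ X.space := SimplicialComplex.mem_space_iff.2 ⟨s, hs, hx⟩
  have hsupp : ∀ w, baryCoord X x w ≠ 0 → f w ∈ W := fun w hw => by
    have hws : w ∈ s := by
      by_contra hws
      exact hw (hb.2.1 w hws)
    obtain ⟨r, hr, hfr⟩ := hf.2.2.1 s hs
    exact hW r hr (Finset.mem_coe.1 (hfr ▸ mem_image_of_mem f (Finset.mem_coe.2 hws)))
  refine ⟨fun w => mul_nonneg (hb.1 w) (squeezeWeight_nonneg hδ W ha _ _),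
    fun w hw => by simp only [hb.2.1 w hw, zero_mul], ?_, ?_⟩
  · rw [Finset.sum_subset (hU s hs) fun w _ hw => by simp only [hb.2.1 w hw, zero_mul]]
    have := sum_smul_pushCoord (U := U) (baryCoord X x) (fun w _ => hsupp w)
      (squeezeWeight δ W a (baryCoord Y (f x)))
    simp only [smul_eq_mul] at this
    rw [← this, ← baryCoord_map hf hU hxX]
    exact sum_squeezeWeight_mul hδ hWδ a
      (isBarycentric_baryCoord_of_mem_space hW (hf.2.1 hxX)).2.2.1
  · exact Finset.sum_subset (hU s hs) fun w _ hw => by simp only [hb.2.1 w hw, zero_mul, zero_smul]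

lemma squeezeMap_mem_space (hf : IsSimplicialMap X Y f) (hU : ∀ s ∈ X.faces, s ⊆ U)
    (hW : ∀ s ∈ Y.faces, s ⊆ W) (hδ : 0 < δ) (hWδ : W.card * δ < 1)
    {a : ℝ} (ha : a ∈ Icc (0 : ℝ) 1) {x : E} (hx : x ∈ X.space) :
    squeezeMap X Y f U W δ a x ∈ X.space := by
  obtain ⟨s, hs, hxs⟩ := SimplicialComplex.mem_space_iff.1 hx
  exact SimplicialComplex.mem_space_iff.2
    ⟨s, hs, (isBarycentric_squeezeMap hf hU hW hδ hWδ ha hs hxs).mem_convexHull⟩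

lemma map_squeezeMap (hf : IsSimplicialMap X Y f) (hU : ∀ s ∈ X.faces, s ⊆ U)
    (hW : ∀ s ∈ Y.faces, s ⊆ W) (hδ : 0 < δ) (hWδ : W.card * δ < 1)
    {a : ℝ} (ha : a ∈ Icc (0 : ℝ) 1) {x : E} (hx : x ∈ X.space) :
    f (squeezeMap X Y f U W δ a x) = squeezeMap Y Y id W W δ a (f x) := by
  classical
  obtain ⟨s, hs, hxs⟩ := SimplicialComplex.mem_space_iff.1 hx
  obtain ⟨r, hr, h⟩ := (isBarycentric_squeezeMap hf hU hW hδ hWδ ha hs hxs).map hf hU hs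
  rw [← (h.mono (hW r hr)).2.2.2, squeezeMap]
  refine Finset.sum_congr rfl fun v _ => ?_
  congr 1
  simp only [id, baryCoord_map hf hU hx]
  conv_rhs => rw [pushCoord, Finset.sum_mul]
  rw [pushCoord]
  refine Finset.sum_congr rfl fun w _ => ?_
  split_ifs with hw
  · rw [hw]
  · rw [zero_mul]

lemma continuousOn_squeezeMap (hf : IsSimplicialMap X Y f) (hX : X.faces.Finite)
    (hY : Y.faces.Finite) (hU : ∀ s ∈ X.faces, s ⊆ U) (hW : ∀ s ∈ Y.faces, s ⊆ W)
    (hδ : 0 < δ) (hWδ : W.card * δ < 1) :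
    ContinuousOn (fun p : E × ℝ => squeezeMap X Y f U W δ p.2 p.1) (X.space ×ˢ univ) := by
  have hα : ContinuousOn (fun p : E × ℝ => baryCoord X p.1) (X.space ×ˢ univ) :=
    (continuousOn_baryCoord hX hU).comp continuousOn_fst fun p hp => hp.1
  have hβ : ContinuousOn (fun p : E × ℝ => baryCoord Y (f p.1)) (X.space ×ˢ univ) :=
    ((continuousOn_baryCoord hY hW).comp hf.1 hf.2.1).comp continuousOn_fst fun p hp => hp.1
  rw [continuousOn_pi] at hα hβ
  have htrunc : ∀ v, ContinuousOn (fun p : E × ℝ => max (baryCoord Y (f p.1) v - δ) 0)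
      (X.space ×ˢ univ) := fun v => ((hβ v).sub continuousOn_const).sup continuousOn_const
  refine continuousOn_finsetSum _ fun w _ => ((hα w).mul ?_).smul continuousOn_const
  refine ((continuousOn_const.sub continuousOn_snd).mul
    (((htrunc _).div ((hβ _).sup continuousOn_const) fun p _ => ?_).div
      (continuousOn_finsetSum _ fun v _ => htrunc v) fun p hp => ?_)).add continuousOn_snd
  · exact (hδ.trans_le (le_max_right _ _)).ne'
  · exact (sum_truncation_pos hWδ
      (isBarycentric_baryCoord_of_mem_space hW (hf.2.1 hp.1)).2.2.1).ne'

lemma squeezeMap_id_mem_convexHull (hW : ∀ s ∈ Y.faces, s ⊆ W) (hδ : 0 < δ)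
    (hWδ : W.card * δ < 1) {a : ℝ} (ha : a ∈ Icc (0 : ℝ) 1) {s : Finset F} (hs : s ∈ Y.faces)
    {y : F} (hy : y ∈ convexHull ℝ (s : Set F)) :
    squeezeMap Y Y id W W δ a y ∈ convexHull ℝ (s : Set F) :=
  (isBarycentric_squeezeMap (isSimplicialMap_id Y) hW hW hδ hWδ ha hs hy).mem_convexHull

lemma squeezeMap_zero_mem_convexHull (hW : ∀ s ∈ Y.faces, s ⊆ W) (hδ : 0 < δ)
    (hWδ : W.card * δ < 1) {s : Finset F} (hs : s ∈ Y.faces) {y y' : F} (hy' : y' ∈ Y.space)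
    (hy : y ∈ convexHull ℝ (s : Set F))
    (hclose : ∀ v ∈ W, dist (baryCoord Y y v) (baryCoord Y y' v) < δ) :
    squeezeMap Y Y id W W δ 0 y' ∈ convexHull ℝ (s : Set F) := by
  obtain ⟨r, hr, hyr⟩ := SimplicialComplex.mem_space_iff.1 hy'
  have h := isBarycentric_squeezeMap (isSimplicialMap_id Y) hW hW hδ hWδ
    ⟨le_rfl, zero_le_one⟩ hr hyr
  have hzero : ∀ v ∉ s,
      baryCoord Y y' v * squeezeWeight δ W 0 (baryCoord Y (id y')) (id v) = 0 := fun v hv => by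
    by_cases hvr : v ∈ r
    · have hv' := hclose v (hW r hr hvr)
      rw [(isBarycentric_baryCoord hs hy).2.1 v hv, dist_comm, Real.dist_eq, sub_zero] at hv'
      have : baryCoord Y y' v - δ ≤ 0 := by linarith [le_abs_self (baryCoord Y y' v)]
      simp [squeezeWeight, max_eq_right this]
    · exact h.2.1 v hvr
  obtain ⟨h0, -, h1, h2⟩ := h.mono (hW r hr)
  refine IsBarycentric.mem_convexHull ⟨h0, hzero, ?_, ?_⟩
  · rw [← h1]
    exact Finset.sum_subset (hW s hs) fun v _ hv => hzero v hv
  · rw [← h2]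
    exact Finset.sum_subset (hW s hs) fun v _ hv => by rw [hzero v hv, zero_smul]

end squeezeMap

lemma exists_vertex_finset {X : SimplicialComplex ℝ E} (hX : X.faces.Finite) :
    ∃ U : Finset E, ∀ s ∈ X.faces, s ⊆ U := by
  classical
  exact ⟨hX.toFinset.biUnion id, fun s hs =>
    Finset.subset_biUnion_of_mem id (hX.mem_toFinset.2 hs)⟩

lemma exists_dist_baryCoord_lt {Y : SimplicialComplex ℝ F} (hY : Y.faces.Finite) {W : Finset F}
    (hW : ∀ s ∈ Y.faces, s ⊆ W) {δ : ℝ} (hδ : 0 < δ) :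
    ∃ ε > 0, ∀ y ∈ Y.space, ∀ y' ∈ Y.space, dist y y' < ε →
      ∀ v ∈ W, dist (baryCoord Y y v) (baryCoord Y y' v) < δ := by
  have hc : ContinuousOn (fun y => fun v : W => baryCoord Y y v) Y.space :=
    continuousOn_pi.2 fun v => continuousOn_pi.1 (continuousOn_baryCoord hY hW) v
  obtain ⟨ε, hε, h⟩ := Metric.uniformContinuousOn_iff.1
    ((isCompact_space_of_finite hY).uniformContinuousOn_of_continuous hc) δ hδ
  exact ⟨ε, hε, fun y hy y' hy' hd v hv => (dist_le_pi_dist _ _ (⟨v, hv⟩ : W)).trans_lt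
    (h y hy y' hy' hd)⟩

/-- The concatenation of a homotopy `h` with a homotopy `R` starting from `R 0`,
after applying `R 0` to the former. -/
def squeezeHomotopy (R : ℝ → E → E) (h : E × ℝ → E) (p : E × ℝ) : E :=
  R (max (2 * p.2 - 1) 0) (h (p.1, min (2 * p.2) 1))

lemma max_mem_Icc {t : ℝ} (ht : t ∈ Icc (0 : ℝ) 1) : max (2 * t - 1) 0 ∈ Icc (0 : ℝ) 1 :=
  ⟨le_max_right _ _, max_le (by linarith [ht.2]) zero_le_one⟩

lemma min_mem_Icc {t : ℝ} (ht : t ∈ Icc (0 : ℝ) 1) : min (2 * t) 1 ∈ Icc (0 : ℝ) 1 :=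
  ⟨le_min (by linarith [ht.1]) zero_le_one, min_le_right _ _⟩

lemma squeezeHomotopy_zero (R : ℝ → E → E) (h : E × ℝ → E) (x : E) :
    squeezeHomotopy R h (x, 0) = R 0 (h (x, 0)) := by
  simp [squeezeHomotopy]

lemma squeezeHomotopy_one (R : ℝ → E → E) (h : E × ℝ → E) (x : E) :
    squeezeHomotopy R h (x, 1) = R 1 (h (x, 1)) := by
  norm_num [squeezeHomotopy]

lemma squeezeHomotopy_cases (R : ℝ → E → E) (h : E × ℝ → E) (x : E) {t : ℝ} :
    squeezeHomotopy R h (x, t) = R 0 (h (x, min (2 * t) 1)) ∨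
      squeezeHomotopy R h (x, t) = R (max (2 * t - 1) 0) (h (x, 1)) := by
  rcases le_total (2 * t) 1 with ht | ht
  · left
    simp only [squeezeHomotopy]
    rw [max_eq_right (by linarith)]
  · right
    simp only [squeezeHomotopy]
    rw [min_eq_right ht]

lemma continuousOn_squeezeHomotopy {S : Set E} {R : ℝ → E → E} {h : E × ℝ → E}
    (hR : ContinuousOn (fun p : E × ℝ => R p.2 p.1) (S ×ˢ univ))
    (hh : ContinuousOn h (S ×ˢ Icc (0 : ℝ) 1))
    (hmaps : ∀ x ∈ S, ∀ t ∈ Icc (0 : ℝ) 1, h (x, t) ∈ S) :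
    ContinuousOn (squeezeHomotopy R h) (S ×ˢ Icc (0 : ℝ) 1) := by
  have h' : ContinuousOn (fun p : E × ℝ => h (p.1, min (2 * p.2) 1)) (S ×ˢ Icc (0 : ℝ) 1) :=
    hh.comp (by fun_prop) fun p hp => ⟨hp.1, min_mem_Icc hp.2⟩
  have h'' : ContinuousOn (fun p : E × ℝ => max (2 * p.2 - 1) 0) (S ×ˢ Icc (0 : ℝ) 1) := by
    fun_prop
  exact hR.comp (h'.prodMk h'') fun p hp => ⟨hmaps _ hp.1 _ (min_mem_Icc hp.2), mem_univ _⟩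

/-- A simplicial map that is an `ε`-controlled homotopy equivalence, where points of `|Y|` at
distance less than `ε` have barycentric coordinates differing by less than `δ`, is itself a
triangular homotopy equivalence if `δ` is small. -/
lemma EpsControlledHE.triangularHE {X : SimplicialComplex ℝ E} {Y : SimplicialComplex ℝ F}
    (hX : X.faces.Finite) (hY : Y.faces.Finite) {W : Finset F} (hW : ∀ s ∈ Y.faces, s ⊆ W)
    {δ ε : ℝ} (hδ : 0 < δ) (hWδ : W.card * δ < 1)
    (hclose : ∀ y ∈ Y.space, ∀ y' ∈ Y.space, dist y y' < ε →
      ∀ v ∈ W, dist (baryCoord Y y v) (baryCoord Y y' v) < δ)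
    {f : E → F} (hf : IsSimplicialMap X Y f) (h : EpsControlledHE X Y f ε) :
    TriangularHE X Y f := by
  obtain ⟨U, hU⟩ := exists_vertex_finset hX
  obtain ⟨g, h₁, h₂, hgc, hgm, h₁c, h₁m, h₁0, h₁1, h₂c, h₂m, h₂0, h₂1, hfg, hd₁, hd₂⟩ := h
  have hid := isSimplicialMap_id Y
  have h0 : (0 : ℝ) ∈ Icc (0 : ℝ) 1 := ⟨le_rfl, zero_le_one⟩
  set R := squeezeMap X Y f U W δ
  set Q := squeezeMap Y Y id W W δ
  have hRc : ContinuousOn (fun p : E × ℝ => R p.2 p.1) (X.space ×ˢ univ) :=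
    continuousOn_squeezeMap hf hX hY hU hW hδ hWδ
  have hQc : ContinuousOn (fun p : F × ℝ => Q p.2 p.1) (Y.space ×ˢ univ) :=
    continuousOn_squeezeMap hid hY hY hW hW hδ hWδ
  have hRm : ∀ a ∈ Icc (0 : ℝ) 1, ∀ x ∈ X.space, R a x ∈ X.space := fun a ha x hx =>
    squeezeMap_mem_space hf hU hW hδ hWδ ha hx
  have hQm : ∀ a ∈ Icc (0 : ℝ) 1, ∀ y ∈ Y.space, Q a y ∈ Y.space := fun a ha y hy =>
    squeezeMap_mem_space hid hW hW hδ hWδ ha hy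
  have hR1 : ∀ x ∈ X.space, R 1 x = x := fun x hx => squeezeMap_one hU hx
  have hQ1 : ∀ y ∈ Y.space, Q 1 y = y := fun y hy => squeezeMap_one hW hy
  have hfR : ∀ a ∈ Icc (0 : ℝ) 1, ∀ x ∈ X.space, f (R a x) = Q a (f x) := fun a ha x hx =>
    map_squeezeMap hf hU hW hδ hWδ ha hx
  have hQs : ∀ s ∈ Y.faces, ∀ a ∈ Icc (0 : ℝ) 1, ∀ y ∈ convexHull ℝ (s : Set F),
      Q a y ∈ convexHull ℝ (s : Set F) := fun s hs a ha y hy =>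
    squeezeMap_id_mem_convexHull hW hδ hWδ ha hs hy
  have hQ0 : ∀ s ∈ Y.faces, ∀ y ∈ convexHull ℝ (s : Set F), ∀ y' ∈ Y.space, dist y y' < ε →
      Q 0 y' ∈ convexHull ℝ (s : Set F) := fun s hs y hy y' hy' hd =>
    squeezeMap_zero_mem_convexHull hW hδ hWδ hs hy' hy
      (hclose y (SimplicialComplex.mem_space_iff.2 ⟨s, hs, hy⟩) y' hy' hd)
  clear_value R Q
  refine ⟨fun y => R 0 (g y), squeezeHomotopy Q h₁, squeezeHomotopy R h₂, ?_,
    fun y hy => hRm 0 h0 _ (hgm hy), continuousOn_squeezeHomotopy hQc h₁c h₁m,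
    fun y hy t ht => hQm _ (max_mem_Icc ht) _ (h₁m y hy _ (min_mem_Icc ht)), fun y hy => ?_,
    fun y hy => ?_, continuousOn_squeezeHomotopy hRc h₂c h₂m,
    fun x hx t ht => hRm _ (max_mem_Icc ht) _ (h₂m x hx _ (min_mem_Icc ht)), fun x hx => ?_,
    fun x hx => ?_, fun s hs => ?_⟩
  · exact hRc.comp (hgc.prodMk continuousOn_const) fun y hy => ⟨hgm hy, mem_univ _⟩
  · rw [squeezeHomotopy_zero, h₁0 y hy, hfR 0 h0 _ (hgm hy)]
  · rw [squeezeHomotopy_one, h₁1 y hy, hQ1 y hy]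
  · rw [squeezeHomotopy_zero, h₂0 x hx]
  · rw [squeezeHomotopy_one, h₂1 x hx, hR1 x hx]
  · refine ⟨fun y hys => ?_, fun y hys t ht => ?_, fun x hx hxs t ht => ?_⟩
    · have hy : y ∈ Y.space := SimplicialComplex.mem_space_iff.2 ⟨s, hs, hys.1⟩
      rw [hfR 0 h0 _ (hgm hy)]
      exact hQ0 s hs y hys.1 _ (hf.2.1 (hgm hy)) (hfg y hy)
    · have hy : y ∈ Y.space := SimplicialComplex.mem_space_iff.2 ⟨s, hs, hys.1⟩
      rcases squeezeHomotopy_cases Q h₁ y (t := t) with e | e <;> rw [e]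
      · exact hQ0 s hs y hys.1 _ (h₁m y hy _ (min_mem_Icc ht)) (hd₁ y hy _ (min_mem_Icc ht))
      · rw [h₁1 y hy]
        exact hQs s hs _ (max_mem_Icc ht) y hys.1
    · rcases squeezeHomotopy_cases R h₂ x (t := t) with e | e <;> rw [e]
      · have hx' := h₂m x hx _ (min_mem_Icc ht)
        rw [hfR 0 h0 _ hx']
        exact hQ0 s hs _ hxs.1 _ (hf.2.1 hx') (hd₂ x hx _ (min_mem_Icc ht))
      · rw [h₂1 x hx, hfR _ (max_mem_Icc ht) x hx]
        exact hQs s hs _ (max_mem_Icc ht) _ hxs.1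

/-- **Squeezing theorem.** For finite geometric simplicial complexes `X ⊆ ℝ^N`,
`Y ⊆ ℝ^M` there is an `ε₀ > 0` such that every simplicial `ε`-controlled homotopy
equivalence `f : |X| → |Y|` with `0 < ε < ε₀` is homotopic to a `Y`-triangular
homotopy equivalence. -/
theorem squeezing {N M : ℕ}
    (X : Geometry.SimplicialComplex ℝ (EuclideanSpace ℝ (Fin N)))
    (Y : Geometry.SimplicialComplex ℝ (EuclideanSpace ℝ (Fin M)))
    (hX : X.faces.Finite) (hY : Y.faces.Finite) :
    ∃ ε₀ > (0:ℝ), ∀ ε : ℝ, 0 < ε → ε < ε₀ →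
      ∀ f : EuclideanSpace ℝ (Fin N) → EuclideanSpace ℝ (Fin M),
        IsSimplicialMap X Y f → EpsControlledHE X Y f ε →
        ∃ F' : EuclideanSpace ℝ (Fin N) → EuclideanSpace ℝ (Fin M),
          ContinuousOn F' X.space ∧ MapsTo F' X.space Y.space ∧
          HomotopicOn X Y f F' ∧ TriangularHE X Y F' := by
  obtain ⟨W, hW⟩ := exists_vertex_finset hY
  have hpos : (0 : ℝ) < W.card + 1 := by positivity
  have hδ : (0 : ℝ) < 1 / (W.card + 1) := by positivity
  have hWδ : W.card * (1 / (W.card + 1) : ℝ) < 1 := by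
    rw [mul_one_div, div_lt_one hpos]
    linarith
  obtain ⟨ε₀, hε₀, hclose⟩ := exists_dist_baryCoord_lt hY hW hδ
  refine ⟨ε₀, hε₀, fun ε _ hε f hf h => ⟨f, hf.1, hf.2.1,
    ⟨fun p => f p.1, hf.1.comp continuousOn_fst fun p hp => hp.1, fun x hx _ _ => hf.2.1 hx,
      fun _ _ => rfl, fun _ _ => rfl⟩, ?_⟩⟩
  exact h.triangularHE hX hY hW hδ hWδ
    (fun y hy y' hy' hd => hclose y hy y' hy' (hd.trans hε)) hf
end
end

section
/- Let S ⊆ ℝ^N and T ⊆ ℝ^M be finite affinely independent sets with |S| ≥ 2 and |T| ≥ 2, let σ = convexHull(S), τ = convexHull(T), and let f : σ → τ be the restriction of an affine map F : ℝ^N → ℝ^M with F(S) = T (a surjective simplicial map). Let T₀ be a nonempty proper subset of T and ρ = convexHull(T₀). Set k = 2·rad(τ)/diam(σ) and K = diam(τ)/(2·rad(σ)). Then for every ε > 0: {x ∈ σ : f(x) ∈ N_{kε}(ρ)} ⊆ N_ε({x ∈ σ : f(x) ∈ ρ}), and N_ε({x ∈ σ : f(x) ∈ ρ}) ∩ σ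 ⊆ {x ∈ σ : f(x) ∈ N_{Kε}(ρ)}. -/
noncomputable section
open Metric Set

variable {E : Type*} [NormedAddCommGroup E] [NormedSpace ℝ E]

/-- The radius of the simplex spanned by `s`: the distance from the barycentre
(centroid of the vertices) to the boundary. -/
def simplexRad (s : Finset E) : ℝ :=
  Metric.infDist (s.centroid ℝ id) (simplexBoundary s)

/-- Barycentric coordinates of points of a face, extended by zero to the whole simplex. -/
lemma exists_weights_of_mem_convexHull_subset {s t : Finset E} (hts : t ⊆ s) {x : E}
    (hx : x ∈ convexHull ℝ (t : Set E)) :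
    ∃ w : E → ℝ, (∀ y ∈ s, 0 ≤ w y) ∧ ∑ y ∈ s, w y = 1 ∧ ∑ y ∈ s, w y • y = x ∧
      ∀ y ∉ t, w y = 0 := by
  classical
  obtain ⟨w, hw0, hw1, hwx⟩ := Finset.mem_convexHull'.1 hx
  refine ⟨fun y => if y ∈ t then w y else 0, fun y _ => ?_, ?_, ?_, fun y hy => if_neg hy⟩
  · dsimp only
    split_ifs with h
    exacts [hw0 y h, le_rfl]
  · rw [← Finset.sum_subset hts (fun y _ hy => if_neg hy), ← hw1]
    exact Finset.sum_congr rfl fun y hy => if_pos hy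
  · rw [← Finset.sum_subset hts (fun y _ hy => by simp only [if_neg hy, zero_smul]), ← hwx]
    exact Finset.sum_congr rfl fun y hy => by simp only [if_pos hy]

lemma AffineIndependent.weights_eq {s : Finset E}
    (hs : AffineIndependent ℝ ((↑) : s → E)) {v w : E → ℝ}
    (hsum : ∑ y ∈ s, v y = ∑ y ∈ s, w y) (hcomb : ∑ y ∈ s, v y • y = ∑ y ∈ s, w y • y)
    {y : E} (hy : y ∈ s) : v y = w y := by
  have h := affineIndependent_iff.1 hs Finset.univ (fun y => v y - w y) ?_ ?_ ⟨y, hy⟩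
    (Finset.mem_univ _)
  · exact sub_eq_zero.1 h
  · rw [Finset.sum_coe_sort s (fun y => v y - w y), Finset.sum_sub_distrib, hsum, sub_self]
  · rw [Finset.sum_coe_sort s (fun y => (v y - w y) • y)]
    simp only [sub_smul, Finset.sum_sub_distrib, hcomb, sub_self]

lemma centroid_eq_sum_smul {s : Finset E} (hs : s.Nonempty) :
    s.centroid ℝ id = ∑ y ∈ s, (s.card : ℝ)⁻¹ • y := by
  rw [Finset.centroid_eq_centerMass s hs, Finset.centerMass_eq_of_sum_1]
  · simp [Finset.centroidWeights]
  · exact s.sum_centroidWeights_eq_one_of_nonempty ℝ hs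

lemma simplexRad_nonneg (s : Finset E) : 0 ≤ simplexRad s := infDist_nonneg

lemma isClosed_simplexBoundary (s : Finset E) : IsClosed (simplexBoundary s) := by
  have h : simplexBoundary s =
      ⋃ t ∈ {t : Finset E | t ⊂ s ∧ t.Nonempty}, convexHull ℝ (t : Set E) := by
    ext x
    simp only [simplexBoundary, mem_iUnion, exists_prop, mem_ofPred_eq, and_assoc]
  rw [h]
  refine Set.Finite.isClosed_biUnion ?_ fun t _ => t.finite_toSet.isClosed_convexHull ℝ
  exact s.powerset.finite_toSet.subset fun t ht => by
    simpa using ht.1.subset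

lemma simplexRad_pos {s : Finset E} (hs : AffineIndependent ℝ ((↑) : s → E))
    (hcard : 2 ≤ s.card) : 0 < simplexRad s := by
  have hne : s.Nonempty := Finset.card_pos.1 (by lia)
  obtain ⟨a, ha⟩ := hne
  have hbd : (simplexBoundary s).Nonempty := by
    refine ⟨a, ?_⟩
    simp only [simplexBoundary, mem_iUnion]
    refine ⟨{a}, ?_, Finset.singleton_nonempty a, by simp⟩
    refine (Finset.singleton_subset_iff.2 ha).ssubset_of_ne ?_
    rintro rfl
    simp at hcard
  refine ((isClosed_simplexBoundary s).notMem_iff_infDist_pos hbd).1 fun hmem => ?_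
  simp only [simplexBoundary, mem_iUnion] at hmem
  obtain ⟨t, hts, -, hmem⟩ := hmem
  obtain ⟨w, -, hw1, hwx, hw0⟩ := exists_weights_of_mem_convexHull_subset hts.subset hmem
  obtain ⟨j, hj, hjt⟩ := Finset.exists_of_ssubset hts
  have hcard0 : (s.card : ℝ) ≠ 0 := by
    norm_cast
    lia
  have := hs.weights_eq (v := fun _ => (s.card : ℝ)⁻¹) (w := w) (by simp [hw1, hcard0])
    (by rw [hwx, centroid_eq_sum_smul ⟨a, ha⟩]) hj
  rw [hw0 j hjt] at this
  exact hcard0 (inv_eq_zero.1 this)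

/-- A displacement with zero-sum coefficients `c` is at least `simplexRad s` times the `ℓ¹`-norm
of `c`: scaled to leave the simplex from its barycentre, it reaches the boundary at the facet
opposite to a vertex with `|c|` maximal. -/
lemma simplexRad_mul_sum_abs_le_norm {s : Finset E} (hcard : 2 ≤ s.card) {c : E → ℝ}
    (hc : ∑ y ∈ s, c y = 0) : simplexRad s * ∑ y ∈ s, |c y| ≤ ‖∑ y ∈ s, c y • y‖ := by
  classical
  have hne : s.Nonempty := Finset.card_pos.1 (by lia)
  have hn : (0 : ℝ) < s.card := by
    norm_cast
    lia
  obtain ⟨j, hj, hmax⟩ := s.exists_max_image (fun y => |c y|) hne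
  have hsum : ∑ y ∈ s, |c y| ≤ s.card * |c j| := by
    simpa using Finset.sum_le_card_nsmul s (fun y => |c y|) |c j| hmax
  rcases eq_or_ne (c j) 0 with hcj | hcj
  · rw [hcj, abs_zero, mul_zero] at hsum
    exact (mul_nonpos_of_nonneg_of_nonpos (simplexRad_nonneg s) hsum).trans (norm_nonneg _)
  set r : ℝ := ((s.card : ℝ) * c j)⁻¹ with hr
  have hmem : s.centroid ℝ id - r • ∑ y ∈ s, c y • y ∈ simplexBoundary s := by
    simp only [simplexBoundary, mem_iUnion]
    refine ⟨s.erase j, Finset.erase_ssubset hj, ?_, ?_⟩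
    · rw [← Finset.card_pos, Finset.card_erase_of_mem hj]
      lia
    have hj0 : (s.card : ℝ)⁻¹ - r * c j = 0 := by
      rw [hr]
      field_simp
      simp
    refine Finset.mem_convexHull'.2 ⟨fun y => (s.card : ℝ)⁻¹ - r * c y, fun y hy => ?_, ?_, ?_⟩
    · have hle : r * c y ≤ |r| * |c j| :=
        (le_abs_self _).trans (by
          rw [abs_mul]
          exact mul_le_mul_of_nonneg_left (hmax y (Finset.mem_of_mem_erase hy)) (abs_nonneg _))
      have hrj : |r| * |c j| = (s.card : ℝ)⁻¹ := by
        rw [← abs_mul, ← sub_eq_zero.1 hj0, abs_of_pos (inv_pos.2 hn)]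
      linarith
    · rw [Finset.sum_erase s hj0, Finset.sum_sub_distrib, ← Finset.mul_sum, hc]
      simp [hn.ne']
    · rw [Finset.sum_erase s (by simp only [hj0, zero_smul]), centroid_eq_sum_smul hne]
      simp only [sub_smul, Finset.sum_sub_distrib, Finset.smul_sum, mul_smul]
  have hrad : simplexRad s ≤ |r| * ‖∑ y ∈ s, c y • y‖ := by
    refine (infDist_le_dist_of_mem hmem).trans_eq ?_
    rw [dist_eq_norm, sub_sub_cancel, norm_smul, Real.norm_eq_abs]
  have hrj : |r| * (s.card * |c j|) = 1 := by
    rw [hr, abs_inv, abs_mul, abs_of_pos hn]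
    exact inv_mul_cancel₀ (mul_ne_zero hn.ne' (abs_ne_zero.2 hcj))
  calc simplexRad s * ∑ y ∈ s, |c y| ≤ simplexRad s * (s.card * |c j|) :=
        mul_le_mul_of_nonneg_left hsum (simplexRad_nonneg s)
    _ ≤ |r| * ‖∑ y ∈ s, c y • y‖ * (s.card * |c j|) :=
        mul_le_mul_of_nonneg_right hrad (by positivity)
    _ = ‖∑ y ∈ s, c y • y‖ := by rw [mul_right_comm, hrj, one_mul]

/-- The distance from a point of a simplex to a point of a face is controlled from below by the
weight which the point carries outside of the face. -/
lemma two_mul_simplexRad_mul_sum_sdiff_le_dist [DecidableEq E] {s t : Finset E} (hcard : 2 ≤ s.card)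
    (hts : t ⊆ s) {v w : E → ℝ} (hvw : ∑ y ∈ s, v y = ∑ y ∈ s, w y) (hw0 : ∀ y ∈ s \ t, w y = 0) :
    2 * simplexRad s * ∑ y ∈ s \ t, v y ≤ dist (∑ y ∈ s, v y • y) (∑ y ∈ s, w y • y) := by
  have hc : ∑ y ∈ s, (v y - w y) = 0 := by rw [Finset.sum_sub_distrib, hvw, sub_self]
  have hout : ∑ y ∈ s \ t, (v y - w y) = ∑ y ∈ s \ t, v y :=
    Finset.sum_congr rfl fun y hy => by rw [hw0 y hy, sub_zero]
  have habs : 2 * ∑ y ∈ s \ t, v y ≤ ∑ y ∈ s, |v y - w y| := by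
    have h₁ := Finset.sum_sdiff (f := fun y => v y - w y) hts
    have h₂ := Finset.sum_sdiff (f := fun y => |v y - w y|) hts
    have h₃ := (le_abs_self _).trans (Finset.abs_sum_le_sum_abs (fun y => v y - w y) (s \ t))
    have h₄ := (neg_le_abs _).trans (Finset.abs_sum_le_sum_abs (fun y => v y - w y) t)
    linarith
  have h := simplexRad_mul_sum_abs_le_norm hcard hc
  simp only [sub_smul, Finset.sum_sub_distrib] at h
  rw [dist_eq_norm]
  have := mul_le_mul_of_nonneg_left habs (simplexRad_nonneg s)
  linarith

/-- A point of a simplex is close to a face if it carries little weight outside of the face. -/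
lemma exists_mem_convexHull_dist_le [DecidableEq E] {s t : Finset E} (hts : t ⊆ s) (ht : t.Nonempty)
    {w : E → ℝ} (hw0 : ∀ y ∈ s, 0 ≤ w y) (hw1 : ∑ y ∈ s, w y = 1) :
    ∃ p ∈ convexHull ℝ (t : Set E),
      dist (∑ y ∈ s, w y • y) p ≤ (∑ y ∈ s \ t, w y) * diam (convexHull ℝ (s : Set E)) := by
  set m := ∑ y ∈ s \ t, w y with hm
  have hbdd : Bornology.IsBounded (convexHull ℝ (s : Set E)) :=
    (s.finite_toSet.isCompact_convexHull ℝ).isBounded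
  have hsub : convexHull ℝ (t : Set E) ⊆ convexHull ℝ (s : Set E) :=
    convexHull_mono (by exact_mod_cast hts)
  have hsplit : m + ∑ y ∈ t, w y = 1 := by rw [hm, Finset.sum_sdiff hts, hw1]
  -- rescale the weights on `t`, unless they all vanish
  obtain ⟨p, hp, hpw⟩ : ∃ p ∈ convexHull ℝ (t : Set E), ∑ y ∈ t, w y • y = (1 - m) • p := by
    have ht0 : ∀ y ∈ t, 0 ≤ w y := fun y hy => hw0 y (hts hy)
    rcases (Finset.sum_nonneg ht0).eq_or_lt with h | h
    · obtain ⟨a, ha⟩ := ht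
      refine ⟨a, subset_convexHull ℝ _ ha, ?_⟩
      have hz := (Finset.sum_eq_zero_iff_of_nonneg ht0).1 h.symm
      rw [show 1 - m = 0 by linarith, zero_smul]
      exact Finset.sum_eq_zero fun y hy => by rw [hz y hy, zero_smul]
    · refine ⟨t.centerMass w id, t.centerMass_mem_convexHull ht0 h fun y hy => hy, ?_⟩
      rw [show 1 - m = ∑ y ∈ t, w y by linarith, Finset.centerMass, smul_inv_smul₀ h.ne']
      rfl
  refine ⟨p, hp, ?_⟩
  have hdiff : ∑ y ∈ s, w y • y - p = ∑ y ∈ s \ t, w y • (y - p) := by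
    simp only [smul_sub, Finset.sum_sub_distrib]
    rw [← Finset.sum_smul, ← hm, ← Finset.sum_sdiff hts, hpw]
    module
  rw [dist_eq_norm, hdiff, hm, Finset.sum_mul]
  refine (norm_sum_le _ _).trans (Finset.sum_le_sum fun y hy => ?_)
  have hys := (Finset.mem_sdiff.1 hy).1
  rw [norm_smul, Real.norm_of_nonneg (hw0 y hys), ← dist_eq_norm]
  exact mul_le_mul_of_nonneg_left
    (dist_le_diam_of_mem hbdd (subset_convexHull ℝ _ hys) (hsub hp)) (hw0 y hys)

lemma diam_convexHull_pos {s : Finset E} (hcard : 2 ≤ s.card) :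
    0 < diam (convexHull ℝ (s : Set E)) := by
  obtain ⟨a, ha, b, hb, hab⟩ := Finset.one_lt_card.1 (show 1 < s.card by lia)
  exact (dist_pos.2 hab).trans_le (dist_le_diam_of_mem
    (s.finite_toSet.isCompact_convexHull ℝ).isBounded
    (subset_convexHull ℝ _ ha) (subset_convexHull ℝ _ hb))

section Pushforward

variable {E' : Type*} [NormedAddCommGroup E'] [NormedSpace ℝ E']

/-- Barycentric coordinates are pushed forward by an affine map which sends vertices to vertices:
the third conjunct computes the weight outside of a face. -/
lemma exists_pushforward_weights [DecidableEq E] [DecidableEq E'] (F : E →ᵃ[ℝ] E')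
    {s : Finset E} {t t₀ : Finset E'} (hF : ∀ y ∈ s, F y ∈ t)
    {w : E → ℝ} (hw0 : ∀ y ∈ s, 0 ≤ w y) (hw1 : ∑ y ∈ s, w y = 1) :
    ∃ w' : E' → ℝ, (∀ z ∈ t, 0 ≤ w' z) ∧ ∑ z ∈ t, w' z = 1 ∧
      ∑ z ∈ t \ t₀, w' z = ∑ y ∈ s \ {y ∈ s | F y ∈ t₀}, w y ∧
      ∑ z ∈ t, w' z • z = F (∑ y ∈ s, w y • y) := by
  refine ⟨fun z => ∑ y ∈ s with F y = z, w y, fun z _ => ?_, ?_, ?_, ?_⟩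
  · exact Finset.sum_nonneg fun y hy => hw0 y (Finset.mem_of_mem_filter y hy)
  · rw [Finset.sum_fiberwise_of_maps_to hF, hw1]
  · have hmaps : ∀ y ∈ s \ {y ∈ s | F y ∈ t₀}, F y ∈ t \ t₀ := fun y hy => by
      simp only [Finset.mem_sdiff, Finset.mem_filter, not_and] at hy ⊢
      exact ⟨hF y hy.1, hy.2 hy.1⟩
    rw [← Finset.sum_fiberwise_of_maps_to hmaps]
    refine Finset.sum_congr rfl fun z hz => Finset.sum_congr ?_ fun _ _ => rfl
    ext y
    simp only [Finset.mem_sdiff, Finset.mem_filter, not_and] at hz ⊢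
    constructor
    · rintro ⟨hy, rfl⟩
      exact ⟨⟨hy, fun _ => hz.2⟩, rfl⟩
    · rintro ⟨⟨hy, -⟩, rfl⟩
      exact ⟨hy, rfl⟩
  · have hFx : F (∑ y ∈ s, w y • y) = ∑ y ∈ s, w y • F y := by
      have h := s.map_affineCombination (id : E → E) w hw1 F
      rwa [s.affineCombination_eq_linear_combination _ _ hw1,
        s.affineCombination_eq_linear_combination _ _ hw1] at h
    rw [hFx, ← Finset.sum_fiberwise_of_maps_to hF]
    refine Finset.sum_congr rfl fun z _ => ?_
    rw [Finset.sum_smul]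
    exact Finset.sum_congr rfl fun y hy => by rw [(Finset.mem_filter.1 hy).2]

end Pushforward

/-- Lemma 1 of the paper: preimages under a surjective simplicial map of simplices
almost commute with `ε`-neighbourhoods, with constants `k = 2 rad(τ)/diam(σ)` and
`K = diam(τ)/(2 rad(σ))`. -/
theorem preimage_neighbourhood_of_face {N M : ℕ}
    (S : Finset (EuclideanSpace ℝ (Fin N))) (T : Finset (EuclideanSpace ℝ (Fin M)))
    (hS : AffineIndependent ℝ ((↑) : S → EuclideanSpace ℝ (Fin N)))
    (hT : AffineIndependent ℝ ((↑) : T → EuclideanSpace ℝ (Fin M)))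
    (hScard : 2 ≤ S.card) (hTcard : 2 ≤ T.card)
    (F : EuclideanSpace ℝ (Fin N) →ᵃ[ℝ] EuclideanSpace ℝ (Fin M))
    (hF : F '' (S : Set (EuclideanSpace ℝ (Fin N))) = (T : Set (EuclideanSpace ℝ (Fin M))))
    (T₀ : Finset (EuclideanSpace ℝ (Fin M))) (hT₀ : T₀ ⊂ T) (hT₀ne : T₀.Nonempty) :
    ∀ ε : ℝ, 0 < ε →
      ({x ∈ convexHull ℝ (S : Set (EuclideanSpace ℝ (Fin N))) |
          F x ∈ thickening (2 * simplexRad T / Metric.diam (convexHull ℝ (S : Set (EuclideanSpace ℝ (Fin N)))) * ε)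
            (convexHull ℝ (T₀ : Set (EuclideanSpace ℝ (Fin M))))} ⊆
        thickening ε {x ∈ convexHull ℝ (S : Set (EuclideanSpace ℝ (Fin N))) |
          F x ∈ convexHull ℝ (T₀ : Set (EuclideanSpace ℝ (Fin M)))}) ∧
      (thickening ε {x ∈ convexHull ℝ (S : Set (EuclideanSpace ℝ (Fin N))) |
          F x ∈ convexHull ℝ (T₀ : Set (EuclideanSpace ℝ (Fin M)))} ∩
          convexHull ℝ (S : Set (EuclideanSpace ℝ (Fin N))) ⊆
        {x ∈ convexHull ℝ (S : Set (EuclideanSpace ℝ (Fin N))) |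
          F x ∈ thickening (Metric.diam (convexHull ℝ (T : Set (EuclideanSpace ℝ (Fin M)))) / (2 * simplexRad S) * ε)
            (convexHull ℝ (T₀ : Set (EuclideanSpace ℝ (Fin M))))}) := by
  intro ε hε
  have hFmem : ∀ y ∈ S, F y ∈ T := fun y hy => by
    rw [← Finset.mem_coe, ← hF]
    exact mem_image_of_mem F hy
  set S₀ := {y ∈ S | F y ∈ T₀} with hS₀
  have hS₀S : S₀ ⊆ S := Finset.filter_subset _ _
  constructor
  · rintro x ⟨hx, hFx⟩
    obtain ⟨q, hq, hdist⟩ := mem_thickening_iff.1 hFx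
    obtain ⟨v, hv0, hv1, rfl⟩ := Finset.mem_convexHull'.1 hx
    obtain ⟨v', -, hFv1, hFvout, hFvx⟩ :=
      exists_pushforward_weights (t₀ := T₀) F hFmem hv0 hv1
    obtain ⟨w, -, hw1, rfl, hw0⟩ := exists_weights_of_mem_convexHull_subset hT₀.subset hq
    have hlow := two_mul_simplexRad_mul_sum_sdiff_le_dist hTcard hT₀.subset (hFv1.trans hw1.symm)
      fun y hy => hw0 y (Finset.mem_sdiff.1 hy).2
    rw [hFvout, hFvx] at hlow
    have hS₀ne : S₀.Nonempty := by
      obtain ⟨z, hz⟩ := hT₀ne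
      obtain ⟨y, hy, rfl⟩ : z ∈ F '' (S : Set _) := hF ▸ hT₀.subset hz
      exact ⟨y, Finset.mem_filter.2 ⟨hy, hz⟩⟩
    obtain ⟨p, hp, hxp⟩ := exists_mem_convexHull_dist_le hS₀S hS₀ne hv0 hv1
    refine mem_thickening_iff.2 ⟨p, ⟨convexHull_mono (by exact_mod_cast hS₀S) hp, ?_⟩, ?_⟩
    · have himage : F p ∈ convexHull ℝ (F '' (S₀ : Set _)) :=
        F.image_convexHull (S₀ : Set _) ▸ mem_image_of_mem F hp
      refine convexHull_mono ?_ himage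
      rintro _ ⟨y, hy, rfl⟩
      exact (Finset.mem_filter.1 hy).2
    · refine hxp.trans_lt ?_
      have hlt := hlow.trans_lt hdist
      have hdiam := diam_convexHull_pos hScard
      rw [div_mul_eq_mul_div, lt_div_iff₀ hdiam, mul_assoc] at hlt
      exact lt_of_mul_lt_mul_left hlt (mul_nonneg zero_le_two (simplexRad_nonneg T))
  · rintro x ⟨hxS, hx⟩
    refine ⟨hx, ?_⟩
    obtain ⟨y, ⟨hy, hFy⟩, hdist⟩ := mem_thickening_iff.1 hxS
    obtain ⟨v, hv0, hv1, rfl⟩ := Finset.mem_convexHull'.1 hx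
    obtain ⟨w, hw0, hw1, rfl⟩ := Finset.mem_convexHull'.1 hy
    have hwout : ∀ z ∈ S \ S₀, w z = 0 := by
      obtain ⟨w', -, hFw1, hFwout, hFwx⟩ :=
        exists_pushforward_weights (t₀ := T₀) F hFmem hw0 hw1
      obtain ⟨u, -, hu1, hux, hu0⟩ := exists_weights_of_mem_convexHull_subset hT₀.subset hFy
      rw [Finset.sum_eq_zero fun z hz => ?_] at hFwout
      · exact (Finset.sum_eq_zero_iff_of_nonneg
          fun z hz => hw0 z (Finset.mem_sdiff.1 hz).1).1 hFwout.symm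
      · obtain ⟨hzT, hzT₀⟩ := Finset.mem_sdiff.1 hz
        rw [hT.weights_eq (hFw1.trans hu1.symm) (hFwx.trans hux.symm) hzT, hu0 z hzT₀]
    have hlow := (two_mul_simplexRad_mul_sum_sdiff_le_dist hScard hS₀S (hv1.trans hw1.symm)
      hwout).trans_lt hdist
    obtain ⟨v', hFv0, hFv1, hFvout, hFvx⟩ :=
      exists_pushforward_weights (t₀ := T₀) F hFmem hv0 hv1
    obtain ⟨p, hp, hxp⟩ := exists_mem_convexHull_dist_le hT₀.subset hT₀ne hFv0 hFv1
    rw [hFvx, hFvout] at hxp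
    refine mem_thickening_iff.2 ⟨p, hp, hxp.trans_lt ?_⟩
    have hrad : 0 < 2 * simplexRad S := mul_pos two_pos (simplexRad_pos hS hScard)
    rw [div_mul_eq_mul_div, lt_div_iff₀ hrad]
    have := mul_lt_mul_of_pos_right hlow (diam_convexHull_pos hTcard)
    linarith
end
end

section
/- Let S be a finite affinely independent subset of ℝ^N with |S| ≥ 2, and let S = A ∪ B be a partition of S into two nonempty disjoint subsets. Then for every v ∈ convexHull(A) and v′ ∈ convexHull(B), dist(v, v′) ≥ 2·infDist(σ̂, ∂σ), where σ = convexHull(S), σ̂ is the centroid (arithmetic mean) of S, and ∂σ is the union of the convex hulls of the proper nonempty subsets of S. -/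
noncomputable section
open Metric Set

variable {E : Type*} [NormedAddCommGroup E] [NormedSpace ℝ E]

/-- The centroid of a nonempty finset in a vector space is the mean of its elements. -/
theorem centroid_id_eq_smul_sum {S : Finset E} (hS : S.Nonempty) :
    S.centroid ℝ id = ∑ y ∈ S, (S.card : ℝ)⁻¹ • y := by
  rw [Finset.centroid_def, Finset.affineCombination_eq_linear_combination _ _ _
    (S.sum_centroidWeights_eq_one_of_nonempty ℝ hS)]
  simp

/-- The segment from the centroid of `S` in the direction `v' - v`, where `v` lies in the hull
of `A` and `v'` in the hull of a disjoint set `B`, meets the boundary of the simplex at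
parameter at most `A.card / S.card`. -/
theorem exists_centroid_add_smul_mem_simplexBoundary {S A B : Finset E}
    (hAS : A ⊆ S) (hBS : B ⊆ S) (hdisj : Disjoint A B) (hB : B.Nonempty) {v v' : E}
    (hv : v ∈ convexHull ℝ (A : Set E)) (hv' : v' ∈ convexHull ℝ (B : Set E)) :
    ∃ t : ℝ, 0 ≤ t ∧ t ≤ A.card / S.card ∧
      S.centroid ℝ id + t • (v' - v) ∈ simplexBoundary S := by
  classical
  have hA : A.Nonempty := by
    simpa using (convexHull_nonempty_iff (𝕜 := ℝ)).1 ⟨v, hv⟩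
  have hS : S.Nonempty := hA.mono hAS
  obtain ⟨a, ha0, ha1, hav⟩ := Finset.mem_convexHull'.1 hv
  obtain ⟨b, hb0, hb1, hbv⟩ := Finset.mem_convexHull'.1 hv'
  obtain ⟨i, hiA, hi⟩ := A.exists_max_image a hA
  have hiB : i ∉ B := Finset.disjoint_left.1 hdisj hiA
  have hn : (0 : ℝ) < S.card := by exact_mod_cast hS.card_pos
  have hcard : 1 ≤ A.card * a i := by
    rw [← ha1, ← nsmul_eq_mul]
    exact Finset.sum_le_card_nsmul _ _ _ hi
  have hm : 0 < a i := by
    by_contra! h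
    nlinarith [(Nat.cast_nonneg A.card : (0 : ℝ) ≤ A.card)]
  set t : ℝ := (S.card : ℝ)⁻¹ / a i with ht
  have ht0 : 0 ≤ t := by positivity
  have hti : t * a i = (S.card : ℝ)⁻¹ := by rw [ht]; field_simp
  let w : E → ℝ := fun y ↦
    (S.card : ℝ)⁻¹ + t * ((if y ∈ B then b y else 0) - if y ∈ A then a y else 0)
  have hwi : w i = 0 := by simp [w, hiA, hiB, hti]
  have hw0 : ∀ y ∈ S, 0 ≤ w y := by
    intro y _
    have hb : 0 ≤ if y ∈ B then b y else 0 := by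
      split_ifs with h
      exacts [hb0 y h, le_rfl]
    have ha : (if y ∈ A then a y else 0) ≤ a i := by
      split_ifs with h
      exacts [hi y h, hm.le]
    have := mul_le_mul_of_nonneg_left ha ht0
    have := mul_nonneg ht0 hb
    simp only [w, mul_sub]
    linarith
  have hw1 : ∑ y ∈ S, w y = 1 := by
    simp only [w, Finset.sum_add_distrib, ← Finset.mul_sum, Finset.sum_sub_distrib,
      Finset.sum_ite_mem, Finset.inter_eq_right.2 hAS, Finset.inter_eq_right.2 hBS, ha1, hb1]
    simp [hn.ne']
  have hwv : ∑ y ∈ S, w y • y = S.centroid ℝ id + t • (v' - v) := by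
    simp only [w, add_smul, mul_smul, sub_smul, ite_smul, zero_smul, Finset.sum_add_distrib,
      ← Finset.smul_sum, Finset.sum_sub_distrib, Finset.sum_ite_mem,
      Finset.inter_eq_right.2 hAS, Finset.inter_eq_right.2 hBS, hav, hbv,
      centroid_id_eq_smul_sum hS]
  refine ⟨t, ht0, ?_, ?_⟩
  · rw [ht, div_le_div_iff₀ hm hn, inv_mul_cancel₀ hn.ne']
    exact hcard
  · simp only [simplexBoundary, Set.mem_iUnion]
    refine ⟨S.erase i, Finset.erase_ssubset (hAS hiA), ?_, ?_⟩
    · obtain ⟨j, hj⟩ := hB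
      exact ⟨j, Finset.mem_erase.2 ⟨fun h ↦ hiB (h ▸ hj), hBS hj⟩⟩
    · refine Finset.mem_convexHull'.2 ⟨w, fun y hy ↦ hw0 y (Finset.mem_of_mem_erase hy), ?_, ?_⟩
      · rw [Finset.sum_erase _ hwi, hw1]
      · rw [Finset.sum_erase _ (by rw [hwi, zero_smul]), hwv]

/-- The radius bound when the first of the two disjoint faces has at most half the vertices. -/
theorem two_mul_infDist_centroid_simplexBoundary_le_dist {S A B : Finset E}
    (hAS : A ⊆ S) (hBS : B ⊆ S) (hdisj : Disjoint A B) (hB : B.Nonempty)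
    (hcard : 2 * A.card ≤ S.card) {v v' : E}
    (hv : v ∈ convexHull ℝ (A : Set E)) (hv' : v' ∈ convexHull ℝ (B : Set E)) :
    2 * infDist (S.centroid ℝ id) (simplexBoundary S) ≤ dist v v' := by
  obtain ⟨t, ht0, ht, hmem⟩ :=
    exists_centroid_add_smul_mem_simplexBoundary hAS hBS hdisj hB hv hv'
  have hn : (0 : ℝ) < S.card := by exact_mod_cast (hB.mono hBS).card_pos
  have hcard' : 2 * (A.card : ℝ) ≤ S.card := by exact_mod_cast hcard
  have ht2 : 2 * t ≤ 1 := by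
    rw [le_div_iff₀ hn] at ht
    by_contra! h
    nlinarith
  have h := infDist_le_dist_of_mem (x := S.centroid ℝ id) hmem
  rw [dist_self_add_right, norm_smul, Real.norm_of_nonneg ht0, ← dist_eq_norm, dist_comm] at h
  nlinarith [dist_nonneg (x := v) (y := v')]

/-- If `S = A ∪ B` is a partition of the vertex set of a simplex `σ = convexHull S`
into two nonempty complementary faces, then any point of `convexHull A` and any point
of `convexHull B` are at distance at least `2 · rad(σ)`, where
`rad(σ) = infDist(σ̂, ∂σ)`. -/
theorem dist_ge_two_rad_of_complementary_faces {N : ℕ}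
    (S A B : Finset (EuclideanSpace ℝ (Fin N)))
    (hindep : AffineIndependent ℝ ((↑) : S → EuclideanSpace ℝ (Fin N)))
    (hcard : 2 ≤ S.card)
    (hunion : (A : Set (EuclideanSpace ℝ (Fin N))) ∪ (B : Set (EuclideanSpace ℝ (Fin N))) = (S : Set (EuclideanSpace ℝ (Fin N)))) (hdisj : Disjoint A B)
    (hA : A.Nonempty) (hB : B.Nonempty) :
    ∀ v ∈ convexHull ℝ (A : Set (EuclideanSpace ℝ (Fin N))),
    ∀ v' ∈ convexHull ℝ (B : Set (EuclideanSpace ℝ (Fin N))),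
      2 * Metric.infDist (S.centroid ℝ id) (simplexBoundary S) ≤ dist v v' := by
  intro v hv v' hv'
  have hAS : A ⊆ S := Finset.coe_subset.1 (hunion ▸ Set.subset_union_left)
  have hBS : B ⊆ S := Finset.coe_subset.1 (hunion ▸ Set.subset_union_right)
  have hsum : A.card + B.card ≤ S.card := by
    classical
    rw [← Finset.card_union_of_disjoint hdisj]
    exact Finset.card_le_card (Finset.union_subset hAS hBS)
  rcases le_total A.card B.card with h | h
  · exact two_mul_infDist_centroid_simplexBoundary_le_dist hAS hBS hdisj hB (by lia) hv hv'
  · rw [dist_comm]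
    exact two_mul_infDist_centroid_simplexBoundary_le_dist hBS hAS hdisj.symm hA (by lia) hv' hv
end
end

section
/- Let S ⊆ ℝ^N and T ⊆ ℝ^M be finite affinely independent sets, and let F : ℝ^N → ℝ^M be an affine map with F(S) = T. Then for every subset T₀ ⊆ T, { x ∈ convexHull(S) : F(x) ∈ convexHull(T₀) } = convexHull({ v ∈ S : F(v) ∈ T₀ }). In particular, the preimage within a simplex of a face of its image simplex under a surjective simplicial map is itself a face of the simplex. -/
open Metric Set

/-- Barycentric coordinates with respect to a finite affinely independent set are unique. -/
theorem AffineIndependent.weights_eq_of_sum_smul_eq {k E : Type*} [Ring k] [AddCommGroup E]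
    [Module k E] {T : Finset E} (hT : AffineIndependent k ((↑) : T → E)) {a b : E → k}
    (hsum : ∑ t ∈ T, a t = ∑ t ∈ T, b t) (hcomb : ∑ t ∈ T, a t • t = ∑ t ∈ T, b t • t) :
    ∀ t ∈ T, a t = b t := by
  intro t ht
  refine sub_eq_zero.1 (affineIndependent_iff.1 hT Finset.univ (fun t => a t - b t) ?_ ?_
    ⟨t, ht⟩ (Finset.mem_univ _))
  · rw [Finset.sum_coe_sort T (fun t => a t - b t), Finset.sum_sub_distrib, hsum, sub_self]
  · rw [Finset.sum_coe_sort T (fun t => (a t - b t) • t)]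
    simp_rw [sub_smul]
    rw [Finset.sum_sub_distrib, hcomb, sub_self]

/-- An affine map between modules commutes with linear combinations of total weight one. -/
theorem AffineMap.map_sum_smul {k E E' : Type*} [Ring k] [AddCommGroup E] [Module k E]
    [AddCommGroup E'] [Module k E'] (f : E →ᵃ[k] E') {s : Finset E} {w : E → k}
    (hw : ∑ v ∈ s, w v = 1) : f (∑ v ∈ s, w v • v) = ∑ v ∈ s, w v • f v := by
  obtain ⟨c, hc⟩ : ∃ c, ∀ x, f x = f.linear x + c := ⟨f 0, congrFun f.decomp⟩
  simp_rw [hc, smul_add]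
  rw [Finset.sum_add_distrib, ← Finset.sum_smul, hw, one_smul, map_sum]
  simp_rw [map_smul]

/-- The preimage within a simplex of a face of its image simplex under a surjective
simplicial map is itself a face: for an affine map `F` with `F(S) = T` (both finite
affinely independent), and any `T₀ ⊆ T`,
`{x ∈ convexHull S : F x ∈ convexHull T₀} = convexHull {v ∈ S : F v ∈ T₀}`. -/
theorem preimage_face_eq_face {N M : ℕ}
    (S : Finset (EuclideanSpace ℝ (Fin N))) (T : Finset (EuclideanSpace ℝ (Fin M)))
    (hS : AffineIndependent ℝ ((↑) : S → EuclideanSpace ℝ (Fin N)))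
    (hT : AffineIndependent ℝ ((↑) : T → EuclideanSpace ℝ (Fin M)))
    (F : EuclideanSpace ℝ (Fin N) →ᵃ[ℝ] EuclideanSpace ℝ (Fin M))
    (hF : F '' (S : Set (EuclideanSpace ℝ (Fin N))) = (T : Set (EuclideanSpace ℝ (Fin M))))
    (T₀ : Finset (EuclideanSpace ℝ (Fin M))) (hT₀ : T₀ ⊆ T) :
    {x ∈ convexHull ℝ (S : Set (EuclideanSpace ℝ (Fin N))) |
        F x ∈ convexHull ℝ (T₀ : Set (EuclideanSpace ℝ (Fin M)))} =
      convexHull ℝ {v : EuclideanSpace ℝ (Fin N) | v ∈ S ∧ F v ∈ T₀} := by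
  classical
  refine Subset.antisymm ?_ (convexHull_min ?_ ?_)
  · rintro x ⟨hxS, hxT₀⟩
    obtain ⟨w, hw0, hw1, rfl⟩ := Finset.mem_convexHull'.1 hxS
    obtain ⟨u, -, hu1, hu⟩ := Finset.mem_convexHull'.1 hxT₀
    have hmaps : ∀ v ∈ S, F v ∈ T := fun v hv => by
      have h : F v ∈ (T : Set (EuclideanSpace ℝ (Fin M))) := hF ▸ mem_image_of_mem F hv
      exact h
    have hsum : ∑ t ∈ T, ∑ v ∈ S with F v = t, w v = ∑ t ∈ T, if t ∈ T₀ then u t else 0 := by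
      rw [Finset.sum_fiberwise_of_maps_to hmaps, Finset.sum_ite_mem,
        Finset.inter_eq_right.2 hT₀, hw1, hu1]
    have hcomb : ∑ t ∈ T, (∑ v ∈ S with F v = t, w v) • t =
        ∑ t ∈ T, (if t ∈ T₀ then u t else 0) • t := by
      simp_rw [ite_smul, zero_smul]
      rw [Finset.sum_ite_mem, Finset.inter_eq_right.2 hT₀, hu, F.map_sum_smul hw1,
        ← Finset.sum_fiberwise_of_maps_to hmaps]
      refine Finset.sum_congr rfl fun t _ => ?_
      rw [Finset.sum_smul]
      exact Finset.sum_congr rfl fun v hv => by rw [(Finset.mem_filter.1 hv).2]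
    have hfiber := hT.weights_eq_of_sum_smul_eq hsum hcomb
    have hzero : ∀ v ∈ S, F v ∉ T₀ → w v = 0 := fun v hv hvT₀ => by
      have h := hfiber (F v) (hmaps v hv)
      rw [if_neg hvT₀, Finset.sum_eq_zero_iff_of_nonneg
        fun y hy => hw0 y (Finset.mem_filter.1 hy).1] at h
      exact h v (Finset.mem_filter.2 ⟨hv, rfl⟩)
    have hfilter : {v | v ∈ S ∧ F v ∈ T₀} = (↑(S.filter (F · ∈ T₀)) : Set _) := by
      ext v
      simp
    rw [hfilter, Finset.mem_convexHull']
    refine ⟨w, fun v hv => hw0 v (Finset.mem_filter.1 hv).1, ?_, ?_⟩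
    · rw [← hw1]
      exact Finset.sum_filter_of_ne fun v hv hne => by_contra fun h => hne (hzero v hv h)
    · exact Finset.sum_filter_of_ne fun v hv hne => by_contra fun h => hne (by simp [hzero v hv h])
  · exact fun v hv => ⟨subset_convexHull ℝ _ hv.1, subset_convexHull ℝ _ hv.2⟩
  · exact (convex_convexHull ℝ _).inter ((convex_convexHull ℝ _).affine_preimage F)
end

section
/- Let A and B be nonempty finite subsets of ℝ^N, let w ∈ convexHull(A), w′ ∈ convexHull(B), t ∈ [0,1], and set y = (1−t)·w + t·w′. Then t · infDist(w′, affineSpan(A)) = infDist(y, affineSpan(A)) ≤ infDist(y, convexHull(A)) ≤ t · dist(w, w′). -/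
open Metric Set

theorem infDist_lineMap_le {E : Type*} [NormedAddCommGroup E] [NormedSpace ℝ E]
    (s : AffineSubspace ℝ E) {p : E} (hp : p ∈ s) (q : E) (t : ℝ) :
    Metric.infDist (AffineMap.lineMap p q t) (s : Set E) ≤
      |t| * Metric.infDist q (s : Set E) := by
  rcases eq_or_ne t 0 with rfl | ht
  · simp [Metric.infDist_zero_of_mem (show p ∈ (s : Set E) from hp)]
  · rw [← div_le_iff₀' (abs_pos.mpr ht), Metric.le_infDist ⟨p, hp⟩]
    intro z hz
    rw [div_le_iff₀' (abs_pos.mpr ht)]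
    refine (Metric.infDist_le_dist_of_mem (AffineMap.lineMap_mem t hp hz)).trans_eq ?_
    simp [AffineMap.lineMap_apply_module', dist_smul₀]

/-- The distance to an affine subspace is linear along a line issuing from one of its points. -/
theorem infDist_lineMap_eq {E : Type*} [NormedAddCommGroup E] [NormedSpace ℝ E]
    (s : AffineSubspace ℝ E) {p : E} (hp : p ∈ s) (q : E) (t : ℝ) :
    Metric.infDist (AffineMap.lineMap p q t) (s : Set E) =
      |t| * Metric.infDist q (s : Set E) := by
  refine (infDist_lineMap_le s hp q t).antisymm ?_
  rcases eq_or_ne t 0 with rfl | ht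
  · simp [Metric.infDist_nonneg]
  · have h := infDist_lineMap_le s hp (AffineMap.lineMap p q t) t⁻¹
    have hq : AffineMap.lineMap p (AffineMap.lineMap p q t) t⁻¹ = q := by
      simp [AffineMap.lineMap_apply_module', smul_smul, ht]
    rwa [hq, abs_inv, ← div_eq_inv_mul, le_div_iff₀' (abs_pos.mpr ht)] at h

/-- Distance control for points of the join segment `[w, w′]` between two faces:
for `w ∈ convexHull A`, `w′ ∈ convexHull B`, `t ∈ [0,1]` and `y = (1−t)w + tw′`, the
distance from `y` to `affineSpan A` is exactly `t · infDist(w′, affineSpan A)`, and the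
distance from `y` to `convexHull A` is between it and `t · dist(w, w′)`. -/
theorem join_segment_dist_bounds {N : ℕ}
    (A B : Finset (EuclideanSpace ℝ (Fin N))) (hA : A.Nonempty) (hB : B.Nonempty)
    (w w' : EuclideanSpace ℝ (Fin N))
    (hw : w ∈ convexHull ℝ (A : Set (EuclideanSpace ℝ (Fin N))))
    (hw' : w' ∈ convexHull ℝ (B : Set (EuclideanSpace ℝ (Fin N))))
    (t : ℝ) (ht : t ∈ Icc (0:ℝ) 1) :
    t * Metric.infDist w' (affineSpan ℝ (A : Set (EuclideanSpace ℝ (Fin N))) :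
        Set (EuclideanSpace ℝ (Fin N))) =
      Metric.infDist ((1 - t) • w + t • w')
        (affineSpan ℝ (A : Set (EuclideanSpace ℝ (Fin N))) :
          Set (EuclideanSpace ℝ (Fin N))) ∧
    Metric.infDist ((1 - t) • w + t • w')
        (affineSpan ℝ (A : Set (EuclideanSpace ℝ (Fin N))) :
          Set (EuclideanSpace ℝ (Fin N))) ≤
      Metric.infDist ((1 - t) • w + t • w')
        (convexHull ℝ (A : Set (EuclideanSpace ℝ (Fin N)))) ∧
    Metric.infDist ((1 - t) • w + t • w')
        (convexHull ℝ (A : Set (EuclideanSpace ℝ (Fin N)))) ≤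
      t * dist w w' := by
  have hy : (1 - t) • w + t • w' = AffineMap.lineMap w w' t :=
    (AffineMap.lineMap_apply_module w w' t).symm
  rw [hy]
  refine ⟨?_, ?_, ?_⟩
  · rw [infDist_lineMap_eq _ (convexHull_subset_affineSpan _ hw), abs_of_nonneg ht.1]
  · exact Metric.infDist_le_infDist_of_subset (convexHull_subset_affineSpan _) ⟨w, hw⟩
  · refine (Metric.infDist_le_dist_of_mem hw).trans_eq ?_
    rw [dist_lineMap_left, Real.norm_of_nonneg ht.1]
end
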